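/- arXiv:2206.14927 — 2 statements merged into one kernel-verified Lean document; each statement's English description precedes it below -/
import Mathlib

section
/- (One-step expected descent.) Let E be a real finite-dimensional inner product space and F : E → ℝ a differentiable function whose gradient ∇F is ζ-Lipschitz for some ζ > 0 (i.e. ‖∇F(w_1) − ∇F(w_2)‖ ≤ ζ‖w_1 − w_2‖ for all w_1, w_2). Fix w ∈ E, let (Ω, 𝒫) be a probability space, and let G : Ω → E be an integrable random vector with ∫‖G‖² d𝒫 < ∞ satisfying: (i) ⟨E{G}, ∇F(w)⟩ ≥ C·‖∇F(w)‖² for a real C > 0; and (ii) E{‖G‖²} ≤ A + (1 + Γ²)·‖∇F(w)‖² for reals A ≥ 0 and Γ. Let ε ∈ (0,1) and let β be a real with 0 ≤ β ≤ 2Cε/(ζ(1 + Γ²)). Then E{F(w − β·G)} ≤ F(w) − β·C·(1 − ε)·‖∇F(w)‖² + (ζ/2)·β²·A. -/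
open MeasureTheory
open scoped RealInnerProductSpace

/-- A differentiable function with `ζ`-Lipschitz gradient differs from its linearization
by at most `ζ / 2 * ‖v‖ ^ 2`. -/
theorem abs_sub_sub_inner_gradient_le
    {E : Type*} [NormedAddCommGroup E] [InnerProductSpace ℝ E] [CompleteSpace E]
    {F : E → ℝ} (hF : Differentiable ℝ F) {ζ : ℝ}
    (hLip : ∀ w1 w2 : E, ‖gradient F w1 - gradient F w2‖ ≤ ζ * ‖w1 - w2‖) (w v : E) :
    |F (w + v) - F w - ⟪gradient F w, v⟫| ≤ ζ / 2 * ‖v‖ ^ 2 := by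
  have hline (t : ℝ) : HasDerivAt (fun t : ℝ => w + t • v) v t := by
    simpa using ((hasDerivAt_id t).smul_const v).const_add w
  have hderiv (t : ℝ) :
      HasDerivAt (fun t : ℝ => F (w + t • v) - F w - t * ⟪gradient F w, v⟫)
        ⟪gradient F (w + t • v) - gradient F w, v⟫ t := by
    have h := (hF (w + t • v)).hasGradientAt.hasFDerivAt.comp_hasDerivAt t (hline t)
    have h2 := (h.sub_const (F w)).sub ((hasDerivAt_id t).mul_const ⟪gradient F w, v⟫)
    refine h2.congr_deriv ?_
    simp [inner_sub_left]
  have hbound (t : ℝ) :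
      HasDerivAt (fun t : ℝ => ζ / 2 * ‖v‖ ^ 2 * t ^ 2) (ζ * ‖v‖ ^ 2 * t) t := by
    refine ((hasDerivAt_pow 2 t).const_mul (ζ / 2 * ‖v‖ ^ 2)).congr_deriv ?_
    norm_num
    ring
  have key := image_norm_le_of_norm_deriv_right_le_deriv_boundary (a := 0) (b := 1)
    (fun t _ => (hderiv t).continuousAt.continuousWithinAt)
    (fun t _ => (hderiv t).hasDerivWithinAt) (by simp) hbound
    (fun t ht => by
      calc ‖⟪gradient F (w + t • v) - gradient F w, v⟫‖
          ≤ ‖gradient F (w + t • v) - gradient F w‖ * ‖v‖ := norm_inner_le_norm _ _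
        _ ≤ ζ * ‖w + t • v - w‖ * ‖v‖ := by gcongr; exact hLip _ _
        _ = ζ * ‖v‖ ^ 2 * t := by
          rw [add_sub_cancel_left, norm_smul, Real.norm_of_nonneg ht.1]
          ring)
    (Set.right_mem_Icc.2 zero_le_one)
  simpa using key

/-- One-step expected descent (Eq. (C7)): for a differentiable `F` with `ζ`-Lipschitz
gradient and a square-integrable random direction `G` satisfying the gradient-coherence
and second-moment bounds, the expected loss after the step `w − β • G` is bounded by
`F w − βC(1−ε)‖∇F(w)‖² + (ζ/2)β²A`, provided `0 ≤ β ≤ 2Cε/(ζ(1+Γ²))`. -/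
theorem one_step_expected_descent
    {E : Type*} [NormedAddCommGroup E] [InnerProductSpace ℝ E] [FiniteDimensional ℝ E]
    (F : E → ℝ) (hF : Differentiable ℝ F) (ζ : ℝ) (hζ : 0 < ζ)
    (hLip : ∀ w1 w2 : E, ‖gradient F w1 - gradient F w2‖ ≤ ζ * ‖w1 - w2‖)
    (w : E)
    {Ω : Type*} [MeasurableSpace Ω] (P : Measure Ω) [IsProbabilityMeasure P]
    (G : Ω → E) (hG : Integrable G P) (hG2 : Integrable (fun ω => ‖G ω‖ ^ 2) P)
    (C : ℝ) (hC : 0 < C)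
    (hcoh : C * ‖gradient F w‖ ^ 2 ≤ ⟪∫ ω, G ω ∂P, gradient F w⟫)
    (A Γ : ℝ) (hA : 0 ≤ A)
    (hmom : ∫ ω, ‖G ω‖ ^ 2 ∂P ≤ A + (1 + Γ ^ 2) * ‖gradient F w‖ ^ 2)
    (ε : ℝ) (hε : ε ∈ Set.Ioo (0 : ℝ) 1)
    (β : ℝ) (hβ0 : 0 ≤ β) (hβ : β ≤ 2 * C * ε / (ζ * (1 + Γ ^ 2))) :
    ∫ ω, F (w - β • G ω) ∂P ≤
      F w - β * C * (1 - ε) * ‖gradient F w‖ ^ 2 + (ζ / 2) * β ^ 2 * A := by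
  have hstep (ω : Ω) :
      |F (w - β • G ω) - F w + β * ⟪gradient F w, G ω⟫| ≤ ζ / 2 * β ^ 2 * ‖G ω‖ ^ 2 := by
    have h := abs_sub_sub_inner_gradient_le hF hLip w (-(β • G ω))
    rw [inner_neg_right, real_inner_smul_right, sub_neg_eq_add, ← sub_eq_add_neg, norm_neg,
      norm_smul, mul_pow, Real.norm_eq_abs, sq_abs, ← mul_assoc] at h
    exact h
  have hinner : Integrable (fun ω => β * ⟪gradient F w, G ω⟫) P :=
    (hG.const_inner (gradient F w)).const_mul β
  have hquad : Integrable (fun ω => ζ / 2 * β ^ 2 * ‖G ω‖ ^ 2) P := hG2.const_mul _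
  have hmeas : AEStronglyMeasurable (fun ω => F (w - β • G ω)) P :=
    hF.continuous.comp_aestronglyMeasurable
      (aestronglyMeasurable_const.sub (hG.aestronglyMeasurable.const_smul β))
  have hrem : Integrable (fun ω => F (w - β • G ω) - F w + β * ⟪gradient F w, G ω⟫) P :=
    hquad.mono' ((hmeas.sub aestronglyMeasurable_const).add hinner.aestronglyMeasurable)
      (Filter.Eventually.of_forall hstep)
  have hint : Integrable (fun ω => F (w - β • G ω)) P := by
    refine ((hrem.sub hinner).add (integrable_const (F w))).congr
      (Filter.Eventually.of_forall fun ω => ?_)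
    simp
  have hsub : Integrable (fun ω => F (w - β • G ω) - F w) P := hint.sub (integrable_const _)
  have hmono := integral_mono hrem hquad fun ω => (le_abs_self _).trans (hstep ω)
  rw [integral_add hsub hinner,
    integral_sub hint (integrable_const _), integral_const_mul, integral_const_mul,
    integral_inner hG, real_inner_comm] at hmono
  simp only [integral_const, probReal_univ, one_smul] at hmono
  rw [le_div_iff₀ (by positivity)] at hβ
  have hcoh' := mul_le_mul_of_nonneg_left hcoh hβ0
  have hmom' := mul_le_mul_of_nonneg_left hmom (by positivity : 0 ≤ ζ / 2 * β ^ 2)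
  have hmix := mul_le_mul_of_nonneg_right hβ
    (by positivity : 0 ≤ β / 2 * ‖gradient F w‖ ^ 2)
  linarith
end

section
/- (Proposition 1, second bound, Eq. (71).) Under the setting of the first bound of Proposition 1 — E a real finite-dimensional inner product space; F : E → ℝ differentiable with ζ-Lipschitz gradient (ζ > 0) and F ≥ F*; a filtered probability space with processes W, G, β satisfying W(t+1) = W(t) − β(t)·G(t), the conditional coherence ⟨E[G(t)|ℱ_t], ∇F(W(t))⟩ ≥ C‖∇F(W(t))‖² and conditional moment bound E[‖G(t)‖²|ℱ_t] ≤ A + (1+Γ²)‖∇F(W(t))‖² almost surely (C > 0, Γ ≥ 0, A ≥ 0), W(t), β(t) ℱ_t-measurable, all relevant integrability — assume additionally that β(t) ∈ [β_MIN, β_MAX] almost surely with 0 < β_MIN ≤ β_MAX ≤ 2Cε/(ζ(1 + Γ²)) for some ε ∈ (0,1). Then for every T ≥ 1: E{(1/T)·Σ_{t=0}^{T−1} ‖∇F(W(t))‖²} ≤ (E{F(W(0))} − F*)/(C(1−ε)·β_MIN·T) + (Aζ·β_MAX²)/(2C(1−ε)·β_MIN). -/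
open MeasureTheory
open scoped RealInnerProductSpace

section SmoothFunctions

variable {E : Type*} [NormedAddCommGroup E] [InnerProductSpace ℝ E] [CompleteSpace E]
  {F : E → ℝ} {ζ : ℝ}

/-- The descent lemma: a function with `ζ`-Lipschitz gradient lies below its quadratic model. -/
theorem le_add_inner_gradient_add_sq (hF : Differentiable ℝ F)
    (hLip : ∀ w1 w2 : E, ‖gradient F w1 - gradient F w2‖ ≤ ζ * ‖w1 - w2‖) (x v : E) :
    F (x + v) ≤ F x + ⟪gradient F x, v⟫ + ζ / 2 * ‖v‖ ^ 2 := by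
  have hline (s : ℝ) : HasDerivAt (fun s : ℝ => F (x + s • v))
      ⟪gradient F (x + s • v), v⟫ s := by
    have h1 : HasDerivAt (fun s : ℝ => x + s • v) v s := by
      simpa using ((hasDerivAt_id s).smul_const v).const_add x
    have h2 := (hF (x + s • v)).hasGradientAt.hasFDerivAt.comp_hasDerivAt s h1
    rwa [InnerProductSpace.toDual_apply_apply] at h2
  have hmodel (s : ℝ) :
      HasDerivAt (fun s : ℝ => F x + s * ⟪gradient F x, v⟫ + ζ / 2 * s ^ 2 * ‖v‖ ^ 2)
        (⟪gradient F x, v⟫ + ζ * s * ‖v‖ ^ 2) s := by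
    have h1 := (((hasDerivAt_id s).mul_const ⟪gradient F x, v⟫).const_add (F x)).add
      ((((hasDerivAt_id s).pow 2).const_mul (ζ / 2)).mul_const (‖v‖ ^ 2))
    refine h1.congr_deriv ?_
    simp only [id, Nat.cast_ofNat]
    ring
  have hle := image_le_of_deriv_right_le_deriv_boundary (a := 0) (b := 1)
    (fun s _ => (hline s).continuousAt.continuousWithinAt)
    (fun s _ => (hline s).hasDerivWithinAt) (by simp)
    (fun s _ => (hmodel s).continuousAt.continuousWithinAt)
    (fun s _ => (hmodel s).hasDerivWithinAt) (fun s hs => ?_)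
    (Set.right_mem_Icc.2 zero_le_one)
  · simpa using hle
  · have h1 : ⟪gradient F (x + s • v) - gradient F x, v⟫ ≤ ζ * s * ‖v‖ ^ 2 := by
      calc ⟪gradient F (x + s • v) - gradient F x, v⟫
          ≤ ‖gradient F (x + s • v) - gradient F x‖ * ‖v‖ := real_inner_le_norm _ _
        _ ≤ ζ * ‖x + s • v - x‖ * ‖v‖ := by gcongr; exact hLip _ _
        _ = ζ * s * ‖v‖ ^ 2 := by
          rw [add_sub_cancel_left, norm_smul, Real.norm_of_nonneg hs.1]; ring
    rw [inner_sub_left] at h1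
    linarith

/-- The gradient of a smooth function bounded below is controlled by the optimality gap. -/
theorem sq_norm_gradient_le (hF : Differentiable ℝ F) (hζ : 0 < ζ)
    (hLip : ∀ w1 w2 : E, ‖gradient F w1 - gradient F w2‖ ≤ ζ * ‖w1 - w2‖)
    {Fstar : ℝ} (hFstar : ∀ w : E, Fstar ≤ F w) (x : E) :
    ‖gradient F x‖ ^ 2 ≤ 2 * ζ * (F x - Fstar) := by
  have h := (hFstar _).trans (le_add_inner_gradient_add_sq hF hLip x (-(ζ⁻¹ • gradient F x)))
  rw [inner_neg_right, real_inner_smul_right, real_inner_self_eq_norm_sq, norm_neg, norm_smul,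
    Real.norm_of_nonneg (inv_nonneg.2 hζ.le)] at h
  have h2 : ζ / 2 * (ζ⁻¹ * ‖gradient F x‖) ^ 2 = ζ⁻¹ * ‖gradient F x‖ ^ 2 / 2 := by
    field_simp
  have h3 : ζ⁻¹ * ‖gradient F x‖ ^ 2 ≤ 2 * (F x - Fstar) := by linarith
  rw [inv_mul_le_iff₀ hζ] at h3
  linarith

theorem continuous_gradient_of_lipschitz
    (hLip : ∀ w1 w2 : E, ‖gradient F w1 - gradient F w2‖ ≤ ζ * ‖w1 - w2‖) :
    Continuous (gradient F) :=
  (LipschitzWith.of_dist_le_mul (K := ζ.toNNReal) fun x y => by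
    rw [dist_eq_norm, dist_eq_norm]
    exact (hLip x y).trans (by gcongr; exact Real.le_coe_toNNReal ζ)).continuous

end SmoothFunctions

section StochasticStep

variable {E : Type*} [NormedAddCommGroup E] [InnerProductSpace ℝ E] [CompleteSpace E]
  {Ω : Type*} {m m0 : MeasurableSpace Ω} {P : Measure Ω} [IsProbabilityMeasure P]

/-- Expected decrease of the quadratic model along a stochastic direction `G` with step `β`,
where `u` is the current gradient. -/
theorem integral_model_decrease_ge (hm : m ≤ m0) {u G : Ω → E} {β : Ω → ℝ}
    {C Γ ε A ζ b B : ℝ} (hC : 0 < C) (hA : 0 ≤ A) (hζ : 0 < ζ) (hε : ε < 1)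
    (hb : 0 < b) (hB : B ≤ 2 * C * ε / (ζ * (1 + Γ ^ 2)))
    (hu : StronglyMeasurable[m] u) (hβ : StronglyMeasurable[m] β)
    (hu2 : MemLp u 2 P) (hG : MemLp G 2 P)
    (hβrange : ∀ᵐ ω ∂P, b ≤ β ω ∧ β ω ≤ B)
    (hcoh : ∀ᵐ ω ∂P, C * ‖u ω‖ ^ 2 ≤ ⟪(P[G|m]) ω, u ω⟫)
    (hmom : ∀ᵐ ω ∂P, (P[fun ω' => ‖G ω'‖ ^ 2|m]) ω ≤ A + (1 + Γ ^ 2) * ‖u ω‖ ^ 2) :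
    Integrable (fun ω => β ω * ⟪G ω, u ω⟫ - ζ / 2 * (β ω ^ 2 * ‖G ω‖ ^ 2)) P ∧
    C * (1 - ε) * b * ∫ ω, ‖u ω‖ ^ 2 ∂P - ζ / 2 * (A * B ^ 2) ≤
      ∫ ω, (β ω * ⟪G ω, u ω⟫ - ζ / 2 * (β ω ^ 2 * ‖G ω‖ ^ 2)) ∂P := by
  have hu_sq : Integrable (fun ω => ‖u ω‖ ^ 2) P := hu2.integrable_norm_pow two_ne_zero
  have hG_sq : Integrable (fun ω => ‖G ω‖ ^ 2) P := hG.integrable_norm_pow two_ne_zero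
  have hG_int : Integrable G P := hG.integrable one_le_two
  have hβ0 : AEStronglyMeasurable β P := (hβ.mono hm).aestronglyMeasurable
  have hβ_norm : ∀ᵐ ω ∂P, ‖β ω‖ ≤ B := by
    filter_upwards [hβrange] with ω h
    rw [Real.norm_of_nonneg (hb.le.trans h.1)]
    exact h.2
  have hβ_sq_norm : ∀ᵐ ω ∂P, ‖β ω ^ 2‖ ≤ B ^ 2 := by
    filter_upwards [hβ_norm] with ω h
    rw [norm_pow]
    gcongr
  have hinner : Integrable (fun ω => ⟪G ω, β ω • u ω⟫) P := by
    simp only [real_inner_smul_right]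
    have hGu : Integrable (fun ω => ⟪G ω, u ω⟫) P :=
      (hG.norm.integrable_mul hu2.norm).mono' (hG.1.inner hu2.1)
        (ae_of_all _ fun ω => norm_inner_le_norm _ _)
    exact hGu.bdd_mul hβ0 hβ_norm
  have hsq : Integrable (fun ω => β ω ^ 2 * ‖G ω‖ ^ 2) P :=
    hG_sq.bdd_mul (hβ0.pow 2) hβ_sq_norm
  have hcond_inner : P[fun ω => ⟪G ω, β ω • u ω⟫|m] =ᵐ[P] fun ω => ⟪(P[G|m]) ω, β ω • u ω⟫ :=
    condExp_bilin_of_stronglyMeasurable_right (innerSL ℝ) (hβ.smul hu) hinner hG_int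
  have hcond_sq : P[fun ω => β ω ^ 2 * ‖G ω‖ ^ 2|m] =ᵐ[P]
      fun ω => β ω ^ 2 * (P[fun ω' => ‖G ω'‖ ^ 2|m]) ω :=
    condExp_mul_of_stronglyMeasurable_left (hβ.pow 2) hsq hG_sq
  simp only [← real_inner_smul_right]
  refine ⟨hinner.sub (hsq.const_mul _), ?_⟩
  rw [integral_sub hinner (hsq.const_mul _), integral_const_mul,
    ← integral_condExp hm (f := fun ω => ⟪G ω, β ω • u ω⟫),
    ← integral_condExp hm (f := fun ω => β ω ^ 2 * ‖G ω‖ ^ 2), ← integral_const_mul (ζ / 2),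
    ← integral_sub integrable_condExp (integrable_condExp.const_mul _), ← integral_const_mul]
  have hconst : ζ / 2 * (A * B ^ 2) = ∫ _, ζ / 2 * (A * B ^ 2) ∂P := by simp
  rw [hconst, ← integral_sub (hu_sq.const_mul _) (integrable_const _)]
  refine integral_mono_ae ((hu_sq.const_mul _).sub (integrable_const _))
    (integrable_condExp.sub (integrable_condExp.const_mul _)) ?_
  filter_upwards [hcond_inner, hcond_sq, hβrange, hcoh, hmom] with ω h1 h2 h3 h4 h5
  rw [real_inner_smul_right] at h1
  rw [h1, h2]
  have hβ_pos : 0 < β ω := hb.trans_le h3.1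
  have hstep : ζ * (1 + Γ ^ 2) * β ω ≤ 2 * C * ε := by
    rw [le_div_iff₀ (by positivity)] at hB
    calc ζ * (1 + Γ ^ 2) * β ω ≤ ζ * (1 + Γ ^ 2) * B := by gcongr; exact h3.2
      _ ≤ 2 * C * ε := by linarith
  have hε' : 0 ≤ C * (1 - ε) := mul_nonneg hC.le (by linarith)
  have e1 : β ω * (C * ‖u ω‖ ^ 2) ≤ β ω * ⟪(P[G|m]) ω, u ω⟫ := by gcongr
  have e2 : ζ / 2 * (β ω ^ 2 * (P[fun ω' => ‖G ω'‖ ^ 2|m]) ω) ≤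
      ζ / 2 * (β ω ^ 2 * (A + (1 + Γ ^ 2) * ‖u ω‖ ^ 2)) := by gcongr
  have e3 : ζ / 2 * (A * β ω ^ 2) ≤ ζ / 2 * (A * B ^ 2) := by gcongr; exact h3.2
  have e4 : β ω * ‖u ω‖ ^ 2 * (ζ * (1 + Γ ^ 2) * β ω) ≤ β ω * ‖u ω‖ ^ 2 * (2 * C * ε) := by
    gcongr
  have e5 : C * (1 - ε) * b * ‖u ω‖ ^ 2 ≤ C * (1 - ε) * β ω * ‖u ω‖ ^ 2 := by
    gcongr; exact h3.1
  linarith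

end StochasticStep

/-- Proposition 1, second bound (Eq. (71)): under the setting of the first bound,
with mixing parameters clipped to `[β_MIN, β_MAX]` where
`0 < β_MIN ≤ β_MAX ≤ 2Cε/(ζ(1+Γ²))`, the expected average squared gradient norm
satisfies the stated `O(1/T)`-plus-residual bound. -/
theorem afafed_convergence_second_bound
    {E : Type*} [NormedAddCommGroup E] [InnerProductSpace ℝ E] [FiniteDimensional ℝ E]
    (F : E → ℝ) (hF : Differentiable ℝ F) (ζ : ℝ) (hζ : 0 < ζ)
    (hLip : ∀ w1 w2 : E, ‖gradient F w1 - gradient F w2‖ ≤ ζ * ‖w1 - w2‖)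
    (Fstar : ℝ) (hFstar : ∀ w : E, Fstar ≤ F w)
    {Ω : Type*} {m0 : MeasurableSpace Ω} (P : Measure Ω) [IsProbabilityMeasure P]
    (ℱ : Filtration ℕ m0)
    (W G : ℕ → Ω → E) (β : ℕ → Ω → ℝ)
    (C Γ ε A βMIN βMAX : ℝ) (hC : 0 < C) (hΓ : 0 ≤ Γ) (hA : 0 ≤ A)
    (hε : ε ∈ Set.Ioo (0 : ℝ) 1)
    (hβMIN : 0 < βMIN) (hβMINMAX : βMIN ≤ βMAX)
    (hβMAX : βMAX ≤ 2 * C * ε / (ζ * (1 + Γ ^ 2)))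
    (hWmeas : ∀ t, StronglyMeasurable[ℱ t] (W t))
    (hβmeas : ∀ t, StronglyMeasurable[ℱ t] (β t))
    (hupd : ∀ t, ∀ᵐ ω ∂P, W (t + 1) ω = W t ω - β t ω • G t ω)
    (hβrange : ∀ t, ∀ᵐ ω ∂P, βMIN ≤ β t ω ∧ β t ω ≤ βMAX)
    (hintF : ∀ t, Integrable (fun ω => F (W t ω)) P)
    (hintG : ∀ t, Integrable (fun ω => (β t ω) ^ 2 * ‖G t ω‖ ^ 2) P)
    (hcoh : ∀ t, ∀ᵐ ω ∂P,
      C * ‖gradient F (W t ω)‖ ^ 2 ≤ ⟪(P[G t|ℱ t]) ω, gradient F (W t ω)⟫)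
    (hmom : ∀ t, ∀ᵐ ω ∂P,
      (P[fun ω' => ‖G t ω'‖ ^ 2|ℱ t]) ω ≤ A + (1 + Γ ^ 2) * ‖gradient F (W t ω)‖ ^ 2) :
    ∀ T : ℕ, 1 ≤ T →
      ∫ ω, (1 / (T : ℝ)) * ∑ t ∈ Finset.range T, ‖gradient F (W t ω)‖ ^ 2 ∂P ≤
        ((∫ ω, F (W 0 ω) ∂P) - Fstar) / (C * (1 - ε) * βMIN * T) +
          (A * ζ * βMAX ^ 2) / (2 * C * (1 - ε) * βMIN) := by
  have : CompleteSpace E := FiniteDimensional.complete ℝ E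
  obtain ⟨-, hε1⟩ := hε
  have hgrad := continuous_gradient_of_lipschitz hLip
  have hu t : StronglyMeasurable[ℱ t] (fun ω => gradient F (W t ω)) :=
    hgrad.comp_stronglyMeasurable (hWmeas t)
  have hu_sq t : Integrable (fun ω => ‖gradient F (W t ω)‖ ^ 2) P := by
    refine (((hintF t).sub (integrable_const Fstar)).const_mul (2 * ζ)).mono'
      (((hu t).mono (ℱ.le t)).norm.pow 2).aestronglyMeasurable (ae_of_all _ fun ω => ?_)
    rw [Real.norm_of_nonneg (by positivity)]
    exact sq_norm_gradient_le hF hζ hLip hFstar _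
  have hu2 t : MemLp (fun ω => gradient F (W t ω)) 2 P :=
    (memLp_two_iff_integrable_sq_norm ((hu t).mono (ℱ.le t)).aestronglyMeasurable).2 (hu_sq t)
  have hGm t : AEStronglyMeasurable (G t) P := by
    have hβ0 : StronglyMeasurable (β t) := (hβmeas t).mono (ℱ.le t)
    have hW0 := (hWmeas t).mono (ℱ.le t)
    have hW1 := (hWmeas (t + 1)).mono (ℱ.le (t + 1))
    refine (hβ0.measurable.inv.stronglyMeasurable.smul
      (hW0.sub hW1)).aestronglyMeasurable.congr ?_
    filter_upwards [hupd t, hβrange t] with ω h1 h2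
    have hne : β t ω ≠ 0 := (hβMIN.trans_le h2.1).ne'
    simp [h1, smul_smul, inv_mul_cancel₀ hne]
  have hG t : MemLp (G t) 2 P := by
    rw [memLp_two_iff_integrable_sq_norm (hGm t)]
    refine ((hintG t).const_mul (βMIN ^ 2)⁻¹).mono' ((hGm t).norm.pow 2) ?_
    filter_upwards [hβrange t] with ω h
    rw [Real.norm_of_nonneg (by positivity), le_inv_mul_iff₀ (by positivity)]
    gcongr
    exact h.1
  set κ := C * (1 - ε) * βMIN with hκ
  have hκ_pos : 0 < κ := mul_pos (mul_pos hC (by linarith)) hβMIN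
  have hstep t : κ * ∫ ω, ‖gradient F (W t ω)‖ ^ 2 ∂P ≤
      (∫ ω, F (W t ω) ∂P) - (∫ ω, F (W (t + 1) ω) ∂P) + ζ / 2 * (A * βMAX ^ 2) := by
    obtain ⟨hint, hdec⟩ := integral_model_decrease_ge (ℱ.le t) hC hA hζ hε1 hβMIN hβMAX
      (hu t) (hβmeas t) (hu2 t) (hG t) (hβrange t) (hcoh t) (hmom t)
    have hle := integral_mono_ae hint ((hintF t).sub (hintF (t + 1))) (by
      filter_upwards [hupd t] with ω h
      have hd := le_add_inner_gradient_add_sq hF hLip (W t ω) (-(β t ω • G t ω))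
      rw [← sub_eq_add_neg, ← h, inner_neg_right, real_inner_smul_right, norm_neg, norm_smul,
        mul_pow, Real.norm_eq_abs, sq_abs, real_inner_comm] at hd
      simp only [Pi.sub_apply]
      linarith)
    simp only [Pi.sub_apply] at hle
    rw [integral_sub (hintF t) (hintF (t + 1))] at hle
    linarith
  intro T hT
  have hT0 : (0 : ℝ) < T := by exact_mod_cast hT
  have hsum : κ * ∑ t ∈ Finset.range T, ∫ ω, ‖gradient F (W t ω)‖ ^ 2 ∂P ≤
      (∫ ω, F (W 0 ω) ∂P) - Fstar + T * (ζ / 2 * (A * βMAX ^ 2)) := by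
    have hlast : Fstar ≤ ∫ ω, F (W T ω) ∂P := by
      simpa using integral_mono (integrable_const Fstar) (hintF T) fun ω => hFstar (W T ω)
    calc κ * ∑ t ∈ Finset.range T, ∫ ω, ‖gradient F (W t ω)‖ ^ 2 ∂P
        ≤ ∑ t ∈ Finset.range T, ((∫ ω, F (W t ω) ∂P) - (∫ ω, F (W (t + 1) ω) ∂P)
            + ζ / 2 * (A * βMAX ^ 2)) := by
          rw [Finset.mul_sum]
          exact Finset.sum_le_sum fun t _ => hstep t
      _ = (∫ ω, F (W 0 ω) ∂P) - (∫ ω, F (W T ω) ∂P) + T * (ζ / 2 * (A * βMAX ^ 2)) := by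
          rw [Finset.sum_add_distrib, Finset.sum_range_sub' fun t => ∫ ω, F (W t ω) ∂P]
          simp
      _ ≤ _ := by linarith
  rw [integral_const_mul, integral_finsetSum _ fun t _ => hu_sq t]
  have hrhs : ((∫ ω, F (W 0 ω) ∂P) - Fstar) / (κ * T) +
      (A * ζ * βMAX ^ 2) / (2 * C * (1 - ε) * βMIN) =
      ((∫ ω, F (W 0 ω) ∂P) - Fstar + T * (ζ / 2 * (A * βMAX ^ 2))) / (κ * T) := by
    rw [show 2 * C * (1 - ε) * βMIN = 2 * κ by rw [hκ]; ring]
    field_simp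
  rw [hrhs, le_div_iff₀ (by positivity)]
  refine le_of_eq_of_le ?_ hsum
  field_simp
end
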